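/- Let (a_n), (σ_n), (τ_n), (κ_n), (μ_n) be sequences with σ_n, τ_n = Θ(√n), and suppose an integer-valued random variable Y_n satisfies both: (Y_n − μ_n)/σ_n converges in distribution to the standard normal, and P(Y_n = ν) ~ (2πτ_n²)^{−1/2}exp(−(ν−κ_n)²/(2τ_n²)) uniformly for integers ν with (ν−μ_n)/σ_n in a compact interval. Then |κ_n − μ_n| = o(τ_n) and τ_n ~ σ_n, and consequently P(Y_n = ν) ~ (2πσ_n²)^{−1/2}exp(−(ν−μ_n)²/(2σ_n²)). -/

import Mathlib

open Filter MeasureTheory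

/-- If a Gaussian density dominates the standard one on `[0, ∞)`, the two coincide. -/
theorem eq_zero_and_eq_one_of_gaussian_le {m s : ℝ} (hs : 0 < s)
    (h : ∀ x : ℝ, 0 ≤ x → Real.exp (-x ^ 2 / 2) ≤ Real.exp (-((x - m) ^ 2 / (2 * s ^ 2))) / s) :
    m = 0 ∧ s = 1 := by
  have hlog : ∀ x : ℝ, 0 ≤ x → (x - m) ^ 2 + 2 * s ^ 2 * Real.log s ≤ s ^ 2 * x ^ 2 := by
    intro x hx
    have h1 := Real.log_le_log (Real.exp_pos _) (h x hx)
    rw [Real.log_div (Real.exp_ne_zero _) hs.ne', Real.log_exp, Real.log_exp] at h1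
    have h2 := mul_le_mul_of_nonneg_left h1 (by positivity : 0 ≤ 2 * s ^ 2)
    have h3 : 2 * s ^ 2 * (-((x - m) ^ 2 / (2 * s ^ 2)) - Real.log s)
        = -(x - m) ^ 2 - 2 * s ^ 2 * Real.log s := by field_simp
    rw [h3] at h2
    linarith
  have h0 := hlog 0 le_rfl
  have hlog_nonpos : Real.log s ≤ 0 := by
    by_contra! hpos
    have : 0 < 2 * s ^ 2 * Real.log s := by positivity
    nlinarith [sq_nonneg m]
  have hs1 : s = 1 := by
    refine le_antisymm ((Real.log_nonpos_iff hs.le).1 hlog_nonpos) ?_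
    by_contra! hlt
    set B := -(2 * s ^ 2 * Real.log s) with hB
    have hB0 : 0 ≤ B := by
      have : 0 ≤ 2 * s ^ 2 * -Real.log s := mul_nonneg (by positivity) (by linarith)
      linarith
    have hd : 0 < 1 - s ^ 2 := by nlinarith
    set x := (2 * |m| + B + 1) / (1 - s ^ 2) with hx
    have hx1 : 1 ≤ x := by
      rw [hx, le_div_iff₀ hd]
      nlinarith [abs_nonneg m, sq_nonneg s]
    have hxm : x * (1 - s ^ 2) = 2 * |m| + B + 1 := div_mul_cancel₀ _ hd.ne'
    have hxx : x ^ 2 * (1 - s ^ 2) = x * (2 * |m| + B + 1) := by rw [← hxm]; ring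
    have hm : x * m ≤ x * |m| := mul_le_mul_of_nonneg_left (le_abs_self m) (by linarith)
    nlinarith [hlog x (by linarith), sq_nonneg m, mul_nonneg (sub_nonneg.2 hx1) hB0]
  subst hs1
  simp only [Real.log_one] at h0
  exact ⟨by nlinarith [sq_nonneg m], rfl⟩

theorem mul_exp_le_integral_Iic_sub {a b : ℝ} (ha : 0 ≤ a) (hab : a ≤ b) :
    (b - a) * (Real.exp (-b ^ 2 / 2) / Real.sqrt (2 * Real.pi)) ≤
      (∫ x in Set.Iic b, Real.exp (-x ^ 2 / 2) / Real.sqrt (2 * Real.pi)) -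
        ∫ x in Set.Iic a, Real.exp (-x ^ 2 / 2) / Real.sqrt (2 * Real.pi) := by
  have hint : Integrable fun x : ℝ => Real.exp (-x ^ 2 / 2) / Real.sqrt (2 * Real.pi) := by
    refine Integrable.div_const ?_ _
    convert integrable_exp_neg_mul_sq (b := 1 / 2) (by norm_num) using 3
    ring
  rw [intervalIntegral.integral_Iic_sub_Iic hint.integrableOn hint.integrableOn,
    ← smul_eq_mul, ← intervalIntegral.integral_const]
  refine intervalIntegral.integral_mono_on hab (by simp) hint.intervalIntegrable ?_
  intro x hx
  have : x ^ 2 ≤ b ^ 2 := pow_le_pow_left₀ (ha.trans hx.1) hx.2 2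
  gcongr

/-- Pigeonhole for an integer-valued map: some atom of a window carries at least the average mass.
No measurability is needed, since only subadditivity is used. -/
theorem exists_int_cdf_sub_le {Ω : Type*} [MeasurableSpace Ω] (P : Measure Ω)
    [IsFiniteMeasure P] (Y : Ω → ℤ) {μ σ a b : ℝ} (hσ : 0 < σ) (hab : 1 ≤ (b - a) * σ) :
    ∃ ν : ℤ, ((ν : ℝ) - μ) / σ ∈ Set.Icc a b ∧
      P.real {ω | ((Y ω : ℝ) - μ) / σ ≤ b} - P.real {ω | ((Y ω : ℝ) - μ) / σ ≤ a} ≤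
        ((b - a) * σ + 1) * P.real {ω | Y ω = ν} := by
  set W := Finset.Ioc ⌊μ + a * σ⌋ ⌊μ + b * σ⌋ with hW
  have hmem : ∀ k : ℤ, k ∈ W ↔ a < ((k : ℝ) - μ) / σ ∧ ((k : ℝ) - μ) / σ ≤ b := by
    intro k
    rw [hW, Finset.mem_Ioc, Int.floor_lt, Int.le_floor, lt_div_iff₀ hσ, div_le_iff₀ hσ,
      lt_sub_iff_add_lt', sub_le_iff_le_add']
  have hne : W.Nonempty := by
    refine ⟨⌊μ + b * σ⌋, Finset.right_mem_Ioc.2 (Int.floor_lt.2 ?_)⟩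
    have := Int.lt_floor_add_one (μ + b * σ)
    nlinarith
  obtain ⟨ν, hν, hmax⟩ := W.exists_max_image (fun k => P.real {ω | Y ω = k}) hne
  have hcard : (W.card : ℝ) ≤ (b - a) * σ + 1 := by
    have hle : ⌊μ + a * σ⌋ ≤ ⌊μ + b * σ⌋ := Int.floor_mono (by nlinarith)
    rw [hW, Int.card_Ioc, ← Int.cast_natCast, Int.toNat_of_nonneg (sub_nonneg.2 hle),
      Int.cast_sub]
    linarith [Int.floor_le (μ + b * σ), Int.lt_floor_add_one (μ + a * σ)]
  have hsub : {ω | ((Y ω : ℝ) - μ) / σ ≤ b} ⊆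
      {ω | ((Y ω : ℝ) - μ) / σ ≤ a} ∪ ⋃ k ∈ W, {ω | Y ω = k} := by
    intro ω hω
    by_cases h : ((Y ω : ℝ) - μ) / σ ≤ a
    · exact Or.inl h
    · exact Or.inr (Set.mem_biUnion ((hmem _).2 ⟨not_le.1 h, hω⟩) rfl)
  refine ⟨ν, ⟨((hmem ν).1 hν).1.le, ((hmem ν).1 hν).2⟩, ?_⟩
  calc P.real {ω | ((Y ω : ℝ) - μ) / σ ≤ b} - P.real {ω | ((Y ω : ℝ) - μ) / σ ≤ a}
      ≤ P.real (⋃ k ∈ W, {ω | Y ω = k}) :=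
        sub_le_iff_le_add'.2 ((measureReal_mono hsub).trans (measureReal_union_le _ _))
    _ ≤ ∑ k ∈ W, P.real {ω | Y ω = k} := measureReal_biUnion_finset_le _ _
    _ ≤ W.card • P.real {ω | Y ω = ν} := Finset.sum_le_card_nsmul _ _ _ hmax
    _ ≤ ((b - a) * σ + 1) * P.real {ω | Y ω = ν} := by
        rw [nsmul_eq_mul]
        gcongr

/-- If Gaussian shapes with parameters `(m n, s n)` asymptotically reach the standard Gaussian
value somewhere in each window, then `(m n, s n)` tends to `(0, 1)`. -/
theorem tendsto_of_gaussian_windows {m s : ℕ → ℝ} {c₁ c₂ : ℝ} (hc₁ : 0 < c₁)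
    (hs : ∀ᶠ n in atTop, s n ∈ Set.Icc c₁ c₂)
    (h : ∀ a b : ℝ, 0 ≤ a → a < b → ∃ y : ℕ → ℝ, (∀ᶠ n in atTop, y n ∈ Set.Icc a b) ∧
      ∀ c < Real.exp (-b ^ 2 / 2),
        ∀ᶠ n in atTop, c ≤ Real.exp (-((y n - m n) ^ 2 / (2 * s n ^ 2))) / s n) :
    Tendsto m atTop (nhds 0) ∧ Tendsto s atTop (nhds 1) := by
  obtain ⟨M, hM⟩ : ∃ M : ℝ, ∀ᶠ n in atTop, m n ∈ Set.Icc (-M) M := by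
    obtain ⟨y, hy, hyg⟩ := h 0 1 le_rfl one_pos
    set c := Real.exp (-1 ^ 2 / 2) / 2 with hc
    have hc0 : 0 < c := by positivity
    refine ⟨2 * c₂ ^ 2 / (c * c₁) + 2, ?_⟩
    filter_upwards [hs, hy, hyg c (half_lt_self (Real.exp_pos _))] with n hsn hyn hgn
    have hsn0 : 0 < s n := hc₁.trans_le hsn.1
    set t := (y n - m n) ^ 2 / (2 * s n ^ 2) with ht
    have ht0 : 0 ≤ t := by positivity
    have hexp : Real.exp (-t) * (1 + t) ≤ 1 := by
      calc Real.exp (-t) * (1 + t) ≤ Real.exp (-t) * Real.exp t := by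
            gcongr
            linarith [Real.add_one_le_exp t]
        _ = 1 := by rw [← Real.exp_add]; simp
    rw [le_div_iff₀ hsn0] at hgn
    have h1 : c * c₁ * t ≤ 1 := by
      calc c * c₁ * t ≤ c * s n * (1 + t) := by
            gcongr
            · exact hsn.1
            · linarith
        _ ≤ Real.exp (-t) * (1 + t) := by gcongr
        _ ≤ 1 := hexp
    have h2 : (y n - m n) ^ 2 ≤ 2 * c₂ ^ 2 / (c * c₁) := by
      have h3 : (y n - m n) ^ 2 = 2 * s n ^ 2 * t := by rw [ht]; field_simp
      rw [le_div_iff₀ (by positivity), h3]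
      calc 2 * s n ^ 2 * t * (c * c₁) = 2 * s n ^ 2 * (c * c₁ * t) := by ring
        _ ≤ 2 * s n ^ 2 * 1 := by gcongr
        _ ≤ 2 * c₂ ^ 2 := by
          rw [mul_one]
          have := hsn.2
          gcongr
    constructor <;> nlinarith [hyn.1, hyn.2, sq_nonneg (y n - m n - 1), sq_nonneg (y n - m n + 1)]
  suffices hp : Tendsto (fun n => (m n, s n)) atTop (nhds ((0 : ℝ), (1 : ℝ))) from
    Prod.tendsto_iff _ _ |>.1 hp
  refine (isCompact_Icc.prod isCompact_Icc).tendsto_nhds_of_unique_mapClusterPt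
    (hM.and hs) ?_
  rintro ⟨m', s'⟩ ⟨-, hs'⟩ hcl
  have hs'0 : 0 < s' := hc₁.trans_le hs'.1
  obtain ⟨φ, hφ, hlim⟩ := hcl.tendsto_subseq
  obtain ⟨hm', hss'⟩ := (Prod.tendsto_iff _ _).1 hlim
  have hwin : ∀ a b : ℝ, 0 ≤ a → a < b → ∃ y ∈ Set.Icc a b,
      Real.exp (-b ^ 2 / 2) ≤ Real.exp (-((y - m') ^ 2 / (2 * s' ^ 2))) / s' := by
    intro a b ha hab
    obtain ⟨y, hy, hyg⟩ := h a b ha hab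
    obtain ⟨z, hz, ψ, hψ, hyz⟩ := isCompact_Icc.tendsto_subseq' (x := y ∘ φ)
      (hφ.tendsto_atTop.eventually hy).frequently
    refine ⟨z, hz, le_of_forall_lt_imp_le_of_dense fun c hc => ?_⟩
    have hmψ := hm'.comp hψ.tendsto_atTop
    have hsψ := hss'.comp hψ.tendsto_atTop
    have hg : Tendsto (fun k => Real.exp (-((y (φ (ψ k)) - m (φ (ψ k))) ^ 2 /
        (2 * s (φ (ψ k)) ^ 2))) / s (φ (ψ k))) atTop
        (nhds (Real.exp (-((z - m') ^ 2 / (2 * s' ^ 2))) / s')) :=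
      (Real.continuous_exp.tendsto _ |>.comp
        (((hyz.sub hmψ).pow 2).div ((hsψ.pow 2).const_mul 2) (by positivity)).neg).div hsψ hs'0.ne'
    exact ge_of_tendsto hg ((hφ.tendsto_atTop.comp hψ.tendsto_atTop).eventually (hyg c hc))
  obtain ⟨h0, h1⟩ := eq_zero_and_eq_one_of_gaussian_le hs'0 (m := m') (by
    intro x hx
    choose y hy hyg using fun k : ℕ =>
      hwin x (x + 1 / ((k : ℝ) + 1)) hx (lt_add_of_pos_right _ (by positivity))
    have hb : Tendsto (fun k : ℕ => x + 1 / ((k : ℝ) + 1)) atTop (nhds x) := by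
      simpa using tendsto_one_div_add_atTop_nhds_zero_nat.const_add x
    have hyx : Tendsto y atTop (nhds x) :=
      tendsto_of_tendsto_of_tendsto_of_le_of_le tendsto_const_nhds hb
        (fun k => (hy k).1) (fun k => (hy k).2)
    refine le_of_tendsto_of_tendsto' (b := atTop) ?_ ?_ hyg
    · exact ((by fun_prop : Continuous fun b : ℝ => Real.exp (-b ^ 2 / 2)).tendsto x).comp hb
    · exact ((by fun_prop : Continuous fun b : ℝ =>
        Real.exp (-((b - m') ^ 2 / (2 * s' ^ 2))) / s').tendsto x).comp hyx)
  rw [h0, h1]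

theorem tendsto_gaussian_exponent_sub {y m s : ℕ → ℝ} {C : ℝ} (hy : ∀ n, |y n| ≤ C)
    (hm : Tendsto m atTop (nhds 0)) (hs : Tendsto s atTop (nhds 1)) :
    Tendsto (fun n => y n ^ 2 / 2 - (y n - m n) ^ 2 / (2 * s n ^ 2)) atTop (nhds 0) := by
  have hinv : Tendsto (fun n => (s n ^ 2)⁻¹) atTop (nhds 1) := by
    simpa using (hs.pow 2).inv₀ (by norm_num)
  have hbdd : IsBoundedUnder (· ≤ ·) atTop ((‖·‖) ∘ y) :=
    isBoundedUnder_of ⟨C, hy⟩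
  have hbdd2 : IsBoundedUnder (· ≤ ·) atTop ((‖·‖) ∘ fun n => y n ^ 2) :=
    isBoundedUnder_of ⟨C ^ 2, fun n => by
      simpa using pow_le_pow_left₀ (abs_nonneg _) (hy n) 2⟩
  have h1 : Tendsto (fun n => (1 - (s n ^ 2)⁻¹) / 2) atTop (nhds 0) := by
    simpa using (hinv.const_sub 1).div_const 2
  have h2 : Tendsto (fun n => m n * (s n ^ 2)⁻¹) atTop (nhds 0) := by
    simpa using hm.mul hinv
  have h3 : Tendsto (fun n => m n ^ 2 * (s n ^ 2)⁻¹ / 2) atTop (nhds 0) := by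
    simpa using ((hm.pow 2).mul hinv).div_const 2
  have := ((h1.zero_mul_isBoundedUnder_le hbdd2).add (h2.zero_mul_isBoundedUnder_le hbdd)).sub h3
  simp only [add_zero, sub_zero] at this
  refine this.congr fun n => ?_
  rw [div_eq_mul_inv _ (2 * s n ^ 2), mul_inv]
  ring

/-- A central limit theorem forces a local limit shape to reach, in every window, the value of the
standard Gaussian shape. -/
theorem exists_window_gaussian_le
    {Ω : ℕ → Type*} [∀ n, MeasurableSpace (Ω n)] (P : ∀ n, Measure (Ω n))
    [∀ n, IsFiniteMeasure (P n)] (Y : ∀ n, Ω n → ℤ) {μ σ τ κ : ℕ → ℝ}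
    (hσpos : ∀ n, 0 < σ n) (hτpos : ∀ n, 0 < τ n) (hσ : Tendsto σ atTop atTop)
    (hclt : ∀ a : ℝ,
      Tendsto (fun n => (P n).real {ω | ((Y n ω : ℝ) - μ n) / σ n ≤ a}) atTop
        (nhds (∫ x in Set.Iic a, Real.exp (-x ^ 2 / 2) / Real.sqrt (2 * Real.pi))))
    (hlocal : ∀ C : ℝ, 0 < C → ∀ ν : ℕ → ℤ,
      (∀ n, |(ν n : ℝ) - μ n| ≤ C * σ n) →
      Tendsto (fun n => (P n).real {ω | Y n ω = ν n}
          * (Real.sqrt (2 * Real.pi) * τ n)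
          * Real.exp (((ν n : ℝ) - κ n) ^ 2 / (2 * (τ n) ^ 2))) atTop (nhds 1))
    {a b : ℝ} (ha : 0 ≤ a) (hab : a < b) :
    ∃ y : ℕ → ℝ, (∀ᶠ n in atTop, y n ∈ Set.Icc a b) ∧
      ∀ c < Real.exp (-b ^ 2 / 2), ∀ᶠ n in atTop,
        c ≤ Real.exp (-((y n - (κ n - μ n) / σ n) ^ 2 / (2 * (τ n / σ n) ^ 2))) /
          (τ n / σ n) := by
  have hba : 0 < b - a := sub_pos.2 hab
  have hinv : Tendsto (fun n => (σ n)⁻¹) atTop (nhds 0) := hσ.inv_tendsto_atTop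
  obtain ⟨K, hK⟩ := hinv.bddAbove_range
  have hKσ : ∀ n, 1 ≤ K * σ n := fun n => by
    have := hK (Set.mem_range_self n)
    rwa [inv_le_iff_one_le_mul₀ (hσpos n)] at this
  set C := max b K with hC
  have hbC : b ≤ C := le_max_left _ _
  have hKC : K ≤ C := le_max_right _ _
  have hν : ∀ n, ∃ ν : ℤ, |(ν : ℝ) - μ n| ≤ C * σ n ∧ (1 ≤ (b - a) * σ n →
      ((ν : ℝ) - μ n) / σ n ∈ Set.Icc a b ∧
      (P n).real {ω | ((Y n ω : ℝ) - μ n) / σ n ≤ b} -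
        (P n).real {ω | ((Y n ω : ℝ) - μ n) / σ n ≤ a} ≤
          ((b - a) * σ n + 1) * (P n).real {ω | Y n ω = ν}) := by
    intro n
    have hσn := hσpos n
    by_cases hn : 1 ≤ (b - a) * σ n
    · obtain ⟨ν, hν, hle⟩ := exists_int_cdf_sub_le (P n) (Y n) (μ := μ n) hσn hn
      refine ⟨ν, ?_, fun _ => ⟨hν, hle⟩⟩
      have h1 := (le_div_iff₀ hσn).1 hν.1
      have h2 := (div_le_iff₀ hσn).1 hν.2
      rw [abs_of_nonneg ((mul_nonneg ha hσn.le).trans h1)]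
      exact h2.trans (by gcongr)
    · refine ⟨⌊μ n⌋, ?_, fun h => absurd h hn⟩
      have h1 : 1 ≤ C * σ n := (hKσ n).trans (by gcongr)
      rw [abs_le]
      constructor <;> linarith [Int.floor_le (μ n), Int.lt_floor_add_one (μ n)]
  choose ν hνC hν using hν
  have hlarge : ∀ᶠ n in atTop, 1 ≤ (b - a) * σ n :=
    (hσ.const_mul_atTop hba).eventually_ge_atTop 1
  refine ⟨fun n => ((ν n : ℝ) - μ n) / σ n, hlarge.mono fun n hn => (hν n hn).1, fun c hc => ?_⟩
  have hr := hlocal C ((ha.trans_lt hab).trans_le hbC) ν hνC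
  set r := fun n => (P n).real {ω | Y n ω = ν n} * (Real.sqrt (2 * Real.pi) * τ n)
    * Real.exp (((ν n : ℝ) - κ n) ^ 2 / (2 * (τ n) ^ 2)) with hrdef
  have hD := mul_exp_le_integral_Iic_sub ha hab.le
  set w := Real.sqrt (2 * Real.pi) with hw
  have hw0 : 0 < w := by positivity
  have hlim := (((hclt b).sub (hclt a)).mul_const w).div
    ((hinv.const_add (b - a)).mul hr) (by simpa using hba.ne')
  have hclim : c < ((∫ x in Set.Iic b, Real.exp (-x ^ 2 / 2) / w) -
      ∫ x in Set.Iic a, Real.exp (-x ^ 2 / 2) / w) * w / ((b - a + 0) * 1) := by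
    refine hc.trans_le ?_
    rw [add_zero, mul_one, le_div_iff₀ hba]
    calc Real.exp (-b ^ 2 / 2) * (b - a) = (b - a) * (Real.exp (-b ^ 2 / 2) / w) * w := by
          field_simp
      _ ≤ _ := by gcongr
  filter_upwards [hlarge, hlim.eventually_const_lt hclim, hr.eventually_const_lt one_half_lt_one]
    with n hn hcn hrn
  have hσn := hσpos n
  have hτn := hτpos n
  have hrn0 : 0 < r n := by linarith
  refine hcn.le.trans ?_
  have hexp : (((ν n : ℝ) - μ n) / σ n - (κ n - μ n) / σ n) ^ 2 / (2 * (τ n / σ n) ^ 2)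
      = ((ν n : ℝ) - κ n) ^ 2 / (2 * (τ n) ^ 2) := by
    field_simp
    ring
  have hp : (P n).real {ω | Y n ω = ν n} * w =
      r n * Real.exp (-(((ν n : ℝ) - κ n) ^ 2 / (2 * (τ n) ^ 2))) / τ n := by
    rw [hrdef, Real.exp_neg]
    field_simp
  rw [hexp, Pi.div_apply, div_le_iff₀ (by positivity)]
  calc _ ≤ ((b - a) * σ n + 1) * (P n).real {ω | Y n ω = ν n} * w := by
        gcongr
        exact (hν n hn).2
    _ = _ := by
        rw [mul_assoc, hp]
        field_simp

/-- Matching of Gaussian parameters: a local limit shape with parameters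
`(κ, τ)` together with a CLT with parameters `(μ, σ)` forces `|κ−μ| = o(τ)` and
`τ ~ σ`, whence the local limit theorem holds with parameters `(μ, σ)`. -/
theorem stmt_18
    (Ω : ℕ → Type) (mΩ : ∀ n, MeasurableSpace (Ω n)) (P : ∀ n, Measure (Ω n))
    (hP : ∀ n, IsProbabilityMeasure (P n))
    (Y : ∀ n, Ω n → ℤ) (μ σ τ κ : ℕ → ℝ)
    (hσpos : ∀ n, 0 < σ n) (hτpos : ∀ n, 0 < τ n)
    (hσΘ : ∃ c₁ c₂ : ℝ, 0 < c₁ ∧ 0 < c₂ ∧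
      ∀ᶠ n : ℕ in atTop, c₁ * Real.sqrt n ≤ σ n ∧ σ n ≤ c₂ * Real.sqrt n)
    (hτΘ : ∃ c₁ c₂ : ℝ, 0 < c₁ ∧ 0 < c₂ ∧
      ∀ᶠ n : ℕ in atTop, c₁ * Real.sqrt n ≤ τ n ∧ τ n ≤ c₂ * Real.sqrt n)
    (hclt : ∀ a : ℝ,
      Tendsto (fun n => (P n {ω | ((Y n ω : ℝ) - μ n) / σ n ≤ a}).toReal) atTop
        (nhds (∫ x in Set.Iic a, Real.exp (-x ^ 2 / 2) / Real.sqrt (2 * Real.pi))))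
    (hlocal : ∀ C : ℝ, 0 < C → ∀ ν : ℕ → ℤ,
      (∀ n, |(ν n : ℝ) - μ n| ≤ C * σ n) →
      Tendsto (fun n => (P n {ω | Y n ω = ν n}).toReal
          * (Real.sqrt (2 * Real.pi) * τ n)
          * Real.exp (((ν n : ℝ) - κ n) ^ 2 / (2 * (τ n) ^ 2))) atTop (nhds 1)) :
    Tendsto (fun n => (κ n - μ n) / τ n) atTop (nhds 0) ∧
    Tendsto (fun n => τ n / σ n) atTop (nhds 1) ∧
    (∀ C : ℝ, 0 < C → ∀ ν : ℕ → ℤ,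
      (∀ n, |(ν n : ℝ) - μ n| ≤ C * σ n) →
      Tendsto (fun n => (P n {ω | Y n ω = ν n}).toReal
          * (Real.sqrt (2 * Real.pi) * σ n)
          * Real.exp (((ν n : ℝ) - μ n) ^ 2 / (2 * (σ n) ^ 2))) atTop (nhds 1)) := by
  obtain ⟨c₁, c₂, hc₁, hc₂, hσ'⟩ := hσΘ
  obtain ⟨d₁, d₂, hd₁, hd₂, hτ'⟩ := hτΘ
  have hsqrt : Tendsto (fun n : ℕ => Real.sqrt n) atTop atTop :=
    Real.tendsto_sqrt_atTop.comp tendsto_natCast_atTop_atTop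
  have hσ : Tendsto σ atTop atTop :=
    tendsto_atTop_mono' _ (hσ'.mono fun _ h => h.1) (hsqrt.const_mul_atTop hc₁)
  have hratio : ∀ᶠ n in atTop, τ n / σ n ∈ Set.Icc (d₁ / c₂) (d₂ / c₁) := by
    filter_upwards [hσ', hτ'] with n hσn hτn
    have hσn0 := hσpos n
    constructor
    · rw [div_le_div_iff₀ hc₂ hσn0]
      nlinarith [hσn.2, hτn.1]
    · rw [div_le_div_iff₀ hσn0 hc₁]
      nlinarith [hσn.1, hτn.2]
  obtain ⟨hm, hs⟩ := tendsto_of_gaussian_windows (m := fun n => (κ n - μ n) / σ n)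
    (div_pos hd₁ hc₂) hratio fun a b ha hab =>
      exists_window_gaussian_le P Y hσpos hτpos hσ hclt hlocal ha hab
  refine ⟨?_, hs, fun C hC ν hν => ?_⟩
  · have := hm.div hs one_ne_zero
    rw [zero_div] at this
    refine this.congr fun n => ?_
    have := hσpos n
    have := hτpos n
    simp only [Pi.div_apply]
    field_simp
  · have hy : ∀ n, |((ν n : ℝ) - μ n) / σ n| ≤ C := fun n => by
      rw [abs_div, abs_of_pos (hσpos n), div_le_iff₀ (hσpos n)]
      exact hν n
    have hexp := (Real.continuous_exp.tendsto _).comp (tendsto_gaussian_exponent_sub hy hm hs)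
    have hlim := ((hlocal C hC ν hν).mul (hs.inv₀ one_ne_zero)).mul hexp
    rw [Real.exp_zero, inv_one, mul_one, mul_one] at hlim
    refine hlim.congr fun n => ?_
    have hσn := hσpos n
    have hτn := hτpos n
    have h1 : (((ν n : ℝ) - μ n) / σ n) ^ 2 / 2 = ((ν n : ℝ) - μ n) ^ 2 / (2 * (σ n) ^ 2) := by
      field_simp
    have h2 : (((ν n : ℝ) - μ n) / σ n - (κ n - μ n) / σ n) ^ 2 / (2 * (τ n / σ n) ^ 2)
        = ((ν n : ℝ) - κ n) ^ 2 / (2 * (τ n) ^ 2) := by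
      field_simp
      ring
    simp only [Function.comp_apply]
    rw [h1, h2, Real.exp_sub]
    field_simp
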